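/- arXiv:1403.1035 — 7 statements merged into one kernel-verified Lean document; each statement's English description precedes it below -/
import Mathlib

section
/- Let p and q be prime numbers with p ≡ 3 (mod 4), q ≡ 1 (mod 8), and p^((q−1)/4) ≡ −1 (mod q). Then there are no integers x, y, z satisfying p(qx + y)y + qz² = 1. -/
open NumberTheorySymbols in
/-- If `q ≡ 1 (mod 8)` and `q` times a square is `1` modulo `y ≠ 0`, then `J(y | q) = 1`. -/
lemma jacobiSym_eq_one_of_dvd_one_sub_mul_sq {q : ℕ} (hq8 : q % 8 = 1) {y z : ℤ} (hy : y ≠ 0)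
    (h : y ∣ 1 - (q : ℤ) * z ^ 2) : J(y | q) = 1 := by
  have hqo : Odd q := Nat.odd_iff.mpr (by omega)
  obtain ⟨k, m, hm, hk⟩ := Nat.exists_eq_two_pow_mul_odd (Int.natAbs_ne_zero.mpr hy)
  have hmy : (m : ℤ) ∣ y := Int.natCast_dvd.mpr (hk ▸ Dvd.intro_left _ rfl)
  have hqm : J(q | m) = 1 := by
    have h1 : J((q : ℤ) * z ^ 2 | m) = 1 := by
      rw [← jacobiSym.one_left m]
      exact jacobiSym.mod_left' (Int.modEq_iff_dvd.mpr (hmy.trans h))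
    rw [jacobiSym.mul_left, jacobiSym.pow_left] at h1
    rcases jacobiSym.trichotomy (q : ℤ) m with h2 | h2 | h2
    · simp [h2] at h1
    · exact h2
    · rw [h2] at h1
      nlinarith [sq_nonneg J(z | m)]
  have hmq : J(m | q) = 1 := by
    rw [jacobiSym.quadratic_reciprocity_one_mod_four' hm (by omega), hqm]
  have h2q : J(2 | q) = 1 := by
    rw [jacobiSym.at_two hqo, ZMod.χ₈_nat_mod_eight, hq8]
    decide
  have hneg : J(-y | q) = J(y | q) := by
    rw [jacobiSym.neg _ hqo, ZMod.χ₄_nat_one_mod_four (by omega), one_mul]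
  have habs : J((y.natAbs : ℤ) | q) = 1 := by
    rw [hk]
    push_cast
    rw [jacobiSym.mul_left, jacobiSym.pow_left, h2q, hmq, one_pow, one_mul]
  rcases Int.natAbs_eq y with h3 | h3
  · rwa [← h3] at habs
  · rwa [← hneg, h3, neg_neg]

/-- Let `p` and `q` be primes with `p ≡ 3 (mod 4)`, `q ≡ 1 (mod 8)`, and
`p^((q−1)/4) ≡ −1 (mod q)`. Then there are no integers `x, y, z` satisfying
`p(qx + y)y + qz² = 1`. -/
theorem no_integral_points (p q : ℕ) (hp : p.Prime) (hq : q.Prime)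
    (hp4 : p % 4 = 3) (hq8 : q % 8 = 1)
    (hpq : (p : ZMod q) ^ ((q - 1) / 4) = -1) :
    ¬ ∃ x y z : ℤ, (p : ℤ) * ((q : ℤ) * x + y) * y + (q : ℤ) * z ^ 2 = 1 := by
  rintro ⟨x, y, z, h⟩
  have : Fact q.Prime := ⟨hq⟩
  have hmod : (p : ZMod q) * (y : ZMod q) ^ 2 = 1 := by
    have h' := congrArg (Int.cast : ℤ → ZMod q) h
    push_cast at h'
    rw [ZMod.natCast_self] at h'
    linear_combination h'
  have hy : y ≠ 0 := by
    rintro rfl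
    simp at hmod
  have hJ := jacobiSym_eq_one_of_dvd_one_sub_mul_sq (z := z) hq8 hy
    ⟨(p : ℤ) * ((q : ℤ) * x + y), by linear_combination -h⟩
  rw [← jacobiSym.legendreSym.to_jacobiSym] at hJ
  have hpow : (y : ZMod q) ^ (q / 2) = 1 := by
    rw [← legendreSym.eq_pow, hJ, Int.cast_one]
  have hone : (p : ZMod q) ^ ((q - 1) / 4) * (y : ZMod q) ^ (q / 2) = 1 := by
    rw [show q / 2 = 2 * ((q - 1) / 4) by omega, pow_mul, ← mul_pow, hmod, one_pow]
  rw [hpq, hpow, mul_one] at hone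
  have : Fact (2 < q) := ⟨by have := hq.two_le; omega⟩
  exact ZMod.neg_one_ne_one hone
end

section
/- Let p and q be prime numbers with p ≡ 3 (mod 4), q ≡ 1 (mod 8), and p^((q−1)/4) ≡ −1 (mod q). Then there are no p-adic integers x, y, z ∈ ℤ_p satisfying p(qx + y)y + qz² = −1. -/
/-- Let `p` and `q` be primes with `p ≡ 3 (mod 4)`, `q ≡ 1 (mod 8)`, and
`p^((q−1)/4) ≡ −1 (mod q)`. Then there are no `p`-adic integers `x, y, z ∈ ℤ_p` satisfying
`p(qx + y)y + qz² = −1`. -/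
theorem no_padic_points_neg_one (p q : ℕ) [Fact p.Prime] (hq : q.Prime)
    (hp4 : p % 4 = 3) (hq8 : q % 8 = 1)
    (hpq : (p : ZMod q) ^ ((q - 1) / 4) = -1) :
    ¬ ∃ x y z : ℤ_[p],
      (p : ℤ_[p]) * ((q : ℤ_[p]) * x + y) * y + (q : ℤ_[p]) * z ^ 2 = -1 := by
  rintro ⟨x, y, z, h⟩
  have : Fact q.Prime := ⟨hq⟩
  have hq1 : 1 < q := hq.one_lt
  have hp0 : (p : ZMod q) ≠ 0 := by
    intro h0
    rw [h0, zero_pow (by omega)] at hpq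
    exact one_ne_zero (neg_eq_zero.mp hpq.symm)
  have hsq : IsSquare (p : ZMod q) := by
    rw [ZMod.euler_criterion q hp0, show q / 2 = (q - 1) / 4 * 2 by omega, pow_mul, hpq]
    norm_num
  obtain ⟨a, ha⟩ : IsSquare (q : ZMod p) :=
    (ZMod.exists_sq_eq_prime_iff_of_mod_four_eq_one (p := q) (q := p)
      (by omega) (by omega)).mp hsq
  have hmod := congrArg (PadicInt.toZMod (p := p)) h
  simp only [map_add, map_mul, map_pow, map_neg, map_one, map_natCast,
    CharP.cast_eq_zero, zero_mul, zero_add] at hmod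
  rw [ha] at hmod
  refine ZMod.mod_four_ne_three_of_sq_eq_neg_one (y := a * PadicInt.toZMod z) ?_ hp4
  rw [← hmod]
  ring
end

section
/- Let p and q be prime numbers with p ≡ 3 (mod 4), q ≡ 1 (mod 8), and p^((q−1)/4) ≡ −1 (mod q). Then there are no integers x, y, z with gcd(x, y, z) = 1 such that p(qx + y)y + qz² equals 1 or −1. -/
open scoped NumberTheorySymbols in
theorem jacobiSym_eq_of_dvd_mul_sq_sub {a z s : ℤ} {b : ℕ} (hs : J(s | b) ≠ 0)
    (h : (b : ℤ) ∣ a * z ^ 2 - s) : J(a | b) = J(s | b) := by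
  have hmod : J(a * z ^ 2 | b) = J(s | b) := by
    rw [jacobiSym.mod_left, jacobiSym.mod_left s,
      Int.emod_eq_emod_iff_emod_sub_eq_zero.2 (Int.emod_eq_zero_of_dvd h)]
  rw [jacobiSym.mul_left, jacobiSym.pow_left] at hmod
  rcases jacobiSym.trichotomy z b with hz | hz | hz
  · rw [hz] at hmod
    exact absurd (by simpa using hmod.symm) hs
  · simpa [hz] using hmod
  · simpa [hz] using hmod

open scoped NumberTheorySymbols in
theorem jacobiSym_eq_one_of_dvd_mul_sq_sub_one {q : ℕ} (hq8 : q % 8 = 1) {y z : ℤ} (hy : y ≠ 0)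
    (h : y ∣ (q : ℤ) * z ^ 2 - 1) : J(y | q) = 1 := by
  have hqodd : Odd q := Nat.odd_iff.2 (by omega)
  have hneg : J(-1 | q) = 1 := by
    rw [jacobiSym.at_neg_one hqodd, ZMod.χ₄_nat_one_mod_four (by omega)]
  have htwo : J(2 | q) = 1 := by
    rw [jacobiSym.at_two hqodd, ZMod.χ₈_nat_eq_if_mod_eight]
    simp [hq8, show q % 2 = 1 by omega]
  obtain ⟨k, m, hm, hkm⟩ := Nat.exists_eq_two_pow_mul_odd (Int.natAbs_ne_zero.2 hy)
  have hmy : (m : ℤ) ∣ y := Int.natCast_dvd.2 (hkm ▸ dvd_mul_left m _)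
  have hqm : J((q : ℤ) | m) = 1 := by
    simpa using jacobiSym_eq_of_dvd_mul_sq_sub (by simp) (hmy.trans h)
  have hmq : J((m : ℤ) | q) = 1 := by
    rw [← jacobiSym.quadratic_reciprocity_one_mod_four (by omega) hm, hqm]
  have habs : J((y.natAbs : ℤ) | q) = 1 := by
    rw [hkm]
    push_cast
    rw [jacobiSym.mul_left, jacobiSym.pow_left, htwo, hmq]
    simp
  rcases Int.natAbs_eq y with hy' | hy'
  · rwa [hy']
  · rw [hy', neg_eq_neg_one_mul, jacobiSym.mul_left, hneg, habs, one_mul]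


/-- Let `p` and `q` be primes with `p ≡ 3 (mod 4)`, `q ≡ 1 (mod 8)`, and
`p^((q−1)/4) ≡ −1 (mod q)`. Then there are no integers `x, y, z` with `gcd(x, y, z) = 1`
such that `p(qx + y)y + qz²` equals `1` or `−1`. -/
theorem no_primitive_integral_points (p q : ℕ) (hp : p.Prime) (hq : q.Prime)
    (hp4 : p % 4 = 3) (hq8 : q % 8 = 1)
    (hpq : (p : ZMod q) ^ ((q - 1) / 4) = -1) :
    ¬ ∃ x y z : ℤ, Int.gcd (Int.gcd x y) z = 1 ∧
      ((p : ℤ) * ((q : ℤ) * x + y) * y + (q : ℤ) * z ^ 2 = 1 ∨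
        (p : ℤ) * ((q : ℤ) * x + y) * y + (q : ℤ) * z ^ 2 = -1) := by
  rintro ⟨x, y, z, -, h⟩
  have : Fact q.Prime := ⟨hq⟩
  have : Fact p.Prime := ⟨hp⟩
  have hneg_one_ne : (-1 : ZMod q) ≠ 1 :=
    have : Fact (2 < q) := ⟨by have := hq.two_le; omega⟩
    ZMod.neg_one_ne_one
  obtain ⟨k, hk⟩ : ∃ k, q = 8 * k + 1 := ⟨q / 8, by omega⟩
  have hk4 : (q - 1) / 4 = 2 * k := by omega
  have hk2 : q / 2 = 2 * (2 * k) := by omega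
  rw [hk4] at hpq
  rcases h with h | h
  · have hpy : (p : ZMod q) * (y : ZMod q) ^ 2 = 1 := by
      have hcast := congrArg (Int.cast : ℤ → ZMod q) h
      push_cast at hcast
      simp only [ZMod.natCast_self, zero_mul, zero_add, add_zero] at hcast
      linear_combination hcast
    have hy : y ≠ 0 := by
      rintro rfl
      simp at hpy
    have hjac : jacobiSym y q = 1 :=
      jacobiSym_eq_one_of_dvd_mul_sq_sub_one (z := z) hq8 hy
        ⟨-(p * (q * x + y)), by linear_combination h⟩
    have hpow : (y : ZMod q) ^ (2 * (2 * k)) = 1 := by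
      rw [← hk2, ← legendreSym.eq_pow, jacobiSym.legendreSym.to_jacobiSym, hjac, Int.cast_one]
    have hmul := congrArg (· ^ (2 * k)) hpy
    simp only [mul_pow, ← pow_mul, hpq, hpow, mul_one, one_pow] at hmul
    exact hneg_one_ne hmul
  · have hnp : jacobiSym (-1) p = -1 := by
      rw [jacobiSym.at_neg_one (Nat.odd_iff.2 (by omega)), ZMod.χ₄_nat_three_mod_four hp4]
    have hqp : jacobiSym q p = -1 := by
      rw [← hnp]
      exact jacobiSym_eq_of_dvd_mul_sq_sub (z := z) (by simp [hnp])
        ⟨-((q * x + y) * y), by linear_combination h⟩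
    rw [jacobiSym.quadratic_reciprocity_one_mod_four (by omega) (Nat.odd_iff.2 (by omega)),
      ← jacobiSym.legendreSym.to_jacobiSym] at hqp
    have hpow := legendreSym.eq_pow q p
    rw [hqp, hk2, mul_comm 2, pow_mul, Int.cast_natCast, hpq] at hpow
    exact hneg_one_ne (by simpa using hpow)
end

section
/- Let p and q be prime numbers with p ≡ 3 (mod 4), q ≡ 1 (mod 8), and p^((q−1)/4) ≡ −1 (mod q). Then for every prime number l there exist l-adic integers x, y, z ∈ ℤ_l satisfying p(qx + y)y + qz² = 1. -/
open Polynomial in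
/-- A unit of `ℤ_[l]`, `l` odd, that is a square modulo `l` is the inverse of a square. -/
theorem PadicInt.exists_mul_sq_eq_one {l : ℕ} [Fact l.Prime] (hl : l ≠ 2) {u : ℤ_[l]}
    (hu : toZMod u ≠ 0) (hsq : IsSquare (toZMod u)) : ∃ z : ℤ_[l], u * z ^ 2 = 1 := by
  have norm_lt (x : ℤ_[l]) : ‖x‖ < 1 ↔ toZMod x = 0 := by
    rw [← RingHom.mem_ker, ker_toZMod, IsLocalRing.mem_maximalIdeal, mem_nonunits]
  obtain ⟨r, hr⟩ := hsq
  have hr0 : r ≠ 0 := by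
    rintro rfl
    exact hu (by simpa using hr)
  have h2 : (2 : ZMod l) ≠ 0 := Ring.two_ne_zero (by rwa [ZMod.ringChar_zmod_n])
  obtain ⟨a, ha⟩ := ZMod.ringHom_surjective (toZMod (p := l)) r⁻¹
  let F : ℤ_[l][X] := C u * X ^ 2 - 1
  have hF (z : ℤ_[l]) : F.aeval z = u * z ^ 2 - 1 := by simp [F]
  have hF' : ‖F.derivative.aeval a‖ = 1 := by
    refine le_antisymm (norm_le_one _) (not_lt.mp ?_)
    rw [norm_lt]
    simpa [F, ha, hr, hr0, ← one_add_one_eq_two] using h2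
  obtain ⟨z, hz, -⟩ := hensels_lemma (F := F) (a := a) <| by
    rw [hF', one_pow, norm_lt, hF]
    simp only [map_sub, map_mul, map_pow, map_one, ha, hr]
    field_simp
    ring
  exact ⟨z, sub_eq_zero.mp (hF z ▸ hz)⟩


/-- Let `p` and `q` be primes with `p ≡ 3 (mod 4)`, `q ≡ 1 (mod 8)`, and
`p^((q−1)/4) ≡ −1 (mod q)`. Then for every prime `l` there exist `l`-adic integers
`x, y, z ∈ ℤ_l` satisfying `p(qx + y)y + qz² = 1`. -/
theorem local_points_everywhere (p q : ℕ) (hp : p.Prime) (hq : q.Prime)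
    (hp4 : p % 4 = 3) (hq8 : q % 8 = 1)
    (hpq : (p : ZMod q) ^ ((q - 1) / 4) = -1) :
    ∀ (l : ℕ) [Fact l.Prime], ∃ x y z : ℤ_[l],
      (p : ℤ_[l]) * ((q : ℤ_[l]) * x + y) * y + (q : ℤ_[l]) * z ^ 2 = 1 := by
  intro l hl
  have := Fact.mk hp
  have := Fact.mk hq
  have hne : p ≠ q := by rintro rfl; omega
  have hpq0 : (p : ZMod q) ≠ 0 := by
    rwa [Ne, ZMod.natCast_eq_zero_iff, Nat.prime_dvd_prime_iff_eq hq hp, eq_comm]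
  have hqp0 : (q : ZMod p) ≠ 0 := by
    rwa [Ne, ZMod.natCast_eq_zero_iff, Nat.prime_dvd_prime_iff_eq hp hq]
  have hsq : IsSquare (p : ZMod q) := by
    rw [ZMod.euler_criterion q hpq0, show q / 2 = (q - 1) / 4 * 2 by omega, pow_mul, hpq]
    norm_num
  by_cases hlp : l = p
  · subst hlp
    obtain ⟨z, hz⟩ := PadicInt.exists_mul_sq_eq_one (l := l) (u := q) (by omega)
      (by simpa using hqp0)
      (by simpa using (ZMod.exists_sq_eq_prime_iff_of_mod_four_eq_one (by omega) (by omega)).mp hsq)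
    exact ⟨0, 0, z, by simpa using hz⟩
  by_cases hlq : l = q
  · subst hlq
    obtain ⟨y, hy⟩ := PadicInt.exists_mul_sq_eq_one (l := l) (u := p) (by omega)
      (by simpa using hpq0) (by simpa using hsq)
    exact ⟨0, y, 0, by linear_combination hy⟩
  have isUnit_cast {n : ℕ} (hn : n.Prime) (h : l ≠ n) : IsUnit (n : ℤ_[l]) := by
    rw [PadicInt.isUnit_iff, PadicInt.norm_natCast_eq_one_iff]
    exact (Nat.coprime_primes hl.out hn).mpr h
  obtain ⟨a, ha⟩ := (isUnit_cast hp hlp).exists_right_inv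
  obtain ⟨b, hb⟩ := (isUnit_cast hq hlq).exists_right_inv
  exact ⟨b * (a - 1), 1, 0, by linear_combination ha + p * (a - 1) * hb⟩
end

section
/- Let p and q be prime numbers with p ≡ 3 (mod 4), q ≡ 1 (mod 8), and p^((q−1)/4) ≡ −1 (mod q). If x, y, z ∈ ℤ_q are q-adic integers satisfying p(qx + y)y + qz² = 1, then y is a unit in ℤ_q and the residue of y modulo q is not a square in ℤ/qℤ. -/
/-- Let `p` and `q` be primes with `p ≡ 3 (mod 4)`, `q ≡ 1 (mod 8)`, and
`p^((q−1)/4) ≡ −1 (mod q)`. If `x, y, z ∈ ℤ_q` are `q`-adic integers satisfying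
`p(qx + y)y + qz² = 1`, then `y` is a unit in `ℤ_q` and the residue of `y` modulo `q`
is not a square in `ℤ/qℤ`. -/
theorem q_adic_solution_y_unit_nonsquare (p q : ℕ) (hp : p.Prime) [Fact q.Prime]
    (hp4 : p % 4 = 3) (hq8 : q % 8 = 1)
    (hpq : (p : ZMod q) ^ ((q - 1) / 4) = -1)
    (x y z : ℤ_[q])
    (h : (p : ℤ_[q]) * ((q : ℤ_[q]) * x + y) * y + (q : ℤ_[q]) * z ^ 2 = 1) :
    IsUnit y ∧ ¬ IsSquare (PadicInt.toZMod y : ZMod q) := by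
  have hres : (p : ZMod q) * PadicInt.toZMod y * PadicInt.toZMod y = 1 := by
    simpa using congrArg (PadicInt.toZMod (p := q)) h
  refine ⟨?_, ?_⟩
  · by_contra hy
    have h0 : PadicInt.toZMod y = 0 := by
      rw [← RingHom.mem_ker, PadicInt.ker_toZMod]
      exact (IsLocalRing.mem_maximalIdeal y).2 hy
    simp [h0] at hres
  · rintro ⟨r, hr⟩
    rw [hr] at hres
    have hr0 : r ≠ 0 := by
      rintro rfl
      simp at hres
    have hq : 4 * ((q - 1) / 4) = q - 1 := by omega
    have hpow : ((p : ZMod q) * r ^ 4) ^ ((q - 1) / 4) = 1 := by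
      rw [show (p : ZMod q) * r ^ 4 = 1 by linear_combination hres, one_pow]
    rw [mul_pow, ← pow_mul, hq, ZMod.pow_card_sub_one_eq_one hr0, hpq, mul_one] at hpow
    have : Fact (2 < q) := ⟨by have := (Fact.out : q.Prime).two_le; omega⟩
    exact ZMod.neg_one_ne_one hpow
end

section
/- Let p and q be prime numbers with p ≡ 3 (mod 4), q ≡ 1 (mod 8), and p^((q−1)/4) ≡ −1 (mod q). Let l be an odd prime with l ∤ q such that q is not a square modulo l. If x, y, z ∈ ℤ_l are l-adic integers satisfying p(qx + y)y + qz² = 1, then y is a unit in ℤ_l. -/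
/-- Let `p` and `q` be primes with `p ≡ 3 (mod 4)`, `q ≡ 1 (mod 8)`, and
`p^((q−1)/4) ≡ −1 (mod q)`. Let `l` be an odd prime with `l ∤ q` such that `q` is not a
square modulo `l`. If `x, y, z ∈ ℤ_l` satisfy `p(qx + y)y + qz² = 1`, then `y` is a unit
in `ℤ_l`. -/
theorem l_adic_solution_y_unit (p q l : ℕ) (hp : p.Prime) (hq : q.Prime) [Fact l.Prime]
    (hp4 : p % 4 = 3) (hq8 : q % 8 = 1)
    (hpq : (p : ZMod q) ^ ((q - 1) / 4) = -1)
    (hl2 : l ≠ 2) (hlq : ¬ l ∣ q) (hql : ¬ IsSquare (q : ZMod l))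
    (x y z : ℤ_[l])
    (h : (p : ℤ_[l]) * ((q : ℤ_[l]) * x + y) * y + (q : ℤ_[l]) * z ^ 2 = 1) :
    IsUnit y := by
  by_contra hy
  have hy0 : PadicInt.toZMod y = 0 := by
    rw [← RingHom.mem_ker, PadicInt.ker_toZMod]
    exact (IsLocalRing.mem_maximalIdeal y).2 hy
  have hz : (q : ZMod l) * PadicInt.toZMod z ^ 2 = 1 := by
    simpa [hy0] using congrArg PadicInt.toZMod h
  exact hql ⟨q * PadicInt.toZMod z, by linear_combination -(q : ZMod l) * hz⟩
end

section
/- Let K be an algebraically closed field of characteristic zero, let m, n ≥ 1, let r₁, …, r_n ≥ 1 be integers, and let c ∈ K be nonzero. Let A be the quotient of the polynomial ring K[w₁, …, w_m, z₁, …, z_n] by the principal ideal generated by w₁⋯w_m − c·z₁^{r₁}⋯z_n^{r_n}. Then every unit of A is the image of a nonzero constant of K; that is, A^× = K^×. -/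
open MvPolynomial

/-- The polynomial `w₁⋯w_m − c·z₁^{r₁}⋯z_n^{r_n}` in the variables
`w₁, …, w_m, z₁, …, z_n` (indexed by `Fin m ⊕ Fin n`). -/
noncomputable def multinormPoly (K : Type*) [CommRing K] (m n : ℕ) (r : Fin n → ℕ)
    (c : K) : MvPolynomial (Fin m ⊕ Fin n) K :=
  (∏ i : Fin m, X (Sum.inl i)) - C c * ∏ j : Fin n, X (Sum.inr j) ^ r j

/-- Scaling the `i`-th variable by `T ^ w i` scales a weighted homogeneous polynomial of
weighted degree `e` by `T ^ e`. -/
theorem MvPolynomial.IsWeightedHomogeneous.aeval_C_mul_X_pow {σ K B : Type*} [CommSemiring K]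
    [CommSemiring B] [Algebra K B] {w : σ → ℕ} {q : MvPolynomial σ K} {e : ℕ}
    (hq : IsWeightedHomogeneous w q e) (x : σ → B) :
    aeval (fun i ↦ Polynomial.C (x i) * Polynomial.X ^ w i) q =
      Polynomial.C (aeval x q) * Polynomial.X ^ e := by
  simp only [aeval_def, eval₂_eq, map_sum, Finset.sum_mul]
  refine Finset.sum_congr rfl fun s hs ↦ ?_
  rw [← hq (mem_support_iff.1 hs)]
  simp only [map_mul, map_prod, map_pow, mul_pow, Finset.prod_mul_distrib, ← pow_mul,
    Finset.prod_pow_eq_pow_sum, Finsupp.weight_apply, Finsupp.sum, smul_eq_mul, mul_comm (w _),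
    mul_assoc, Polynomial.algebraMap_apply]

/-- If a positively weighted polynomial ring is divided by a weighted homogeneous prime element,
then every unit of the quotient is constant. -/
theorem MvPolynomial.IsWeightedHomogeneous.exists_eq_algebraMap_of_isUnit_quotient
    {σ K : Type*} [Field K] {w : σ → ℕ} (hw : ∀ i, w i ≠ 0) {p : MvPolynomial σ K} {d : ℕ}
    (hp : IsWeightedHomogeneous w p d) (hprime : Prime p)
    {u : MvPolynomial σ K ⧸ Ideal.span {p}} (hu : IsUnit u) :
    ∃ a : Kˣ, u = algebraMap K _ (a : K) := by
  have : (Ideal.span {p}).IsPrime := (Ideal.span_singleton_prime hprime.ne_zero).2 hprime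
  let π := Ideal.Quotient.mkₐ K (Ideal.span {p})
  let ψ : MvPolynomial σ K →ₐ[K] Polynomial (MvPolynomial σ K ⧸ Ideal.span {p}) :=
    aeval fun i ↦ Polynomial.C (π (X i)) * Polynomial.X ^ w i
  have hker : ∀ q ∈ Ideal.span {p}, ψ q = 0 := by
    intro q hq
    obtain ⟨b, rfl⟩ := Ideal.mem_span_singleton.1 hq
    have hπ : aeval (fun i ↦ π (X i)) p = 0 := by
      rw [← comp_aeval_apply, aeval_X_left_apply]
      exact Ideal.Quotient.eq_zero_iff_mem.2 (Ideal.mem_span_singleton_self p)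
    have hψ : ψ p = 0 := by
      rw [hp.aeval_C_mul_X_pow, hπ, map_zero, zero_mul]
    rw [map_mul, hψ, zero_mul]
  let φ := Ideal.Quotient.liftₐ (Ideal.span {p}) ψ hker
  obtain ⟨v, -, hv⟩ := Polynomial.isUnit_iff.1 (hu.map φ)
  obtain ⟨q, rfl⟩ := Ideal.Quotient.mk_surjective u
  have hφ : φ (Ideal.Quotient.mk _ q) = ψ q := rfl
  rw [hφ] at hv
  have h_eval (t : MvPolynomial σ K ⧸ Ideal.span {p}) :
      (ψ q).eval t = aeval (fun i ↦ π (X i) * t ^ w i) q := by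
    rw [← Polynomial.coe_evalRingHom, ← AlgHom.coe_toRingHom, ← RingHom.comp_apply,
      ← AlgHom.coe_toRingHom]
    congr 1
    ext <;> simp [ψ, Polynomial.algebraMap_apply]
  have h_const : Ideal.Quotient.mk (Ideal.span {p}) q = algebraMap K _ (constantCoeff q) := by
    have h_one : (ψ q).eval 1 = Ideal.Quotient.mk (Ideal.span {p}) q := by
      simp only [h_eval, one_pow, mul_one]
      rw [← comp_aeval_apply, aeval_X_left_apply]
      rfl
    have h_zero : (ψ q).eval 0 = algebraMap K _ (constantCoeff q) := by
      rw [h_eval]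
      simp [hw]
    rw [← h_one, ← h_zero, ← hv, Polynomial.eval_C, Polynomial.eval_C]
  have hne : constantCoeff q ≠ 0 := by
    rintro h
    rw [h_const, h, map_zero] at hu
    exact not_isUnit_zero hu
  exact ⟨Units.mk0 _ hne, h_const⟩

theorem isWeightedHomogeneous_multinormPoly (K : Type*) [CommRing K] (m n : ℕ) (r : Fin n → ℕ)
    (c : K) : IsWeightedHomogeneous (Sum.elim (fun _ ↦ ∑ j, r j) fun _ ↦ m)
      (multinormPoly K m n r c) (m * ∑ j, r j) := by
  refine IsWeightedHomogeneous.sub ?_ ?_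
  · have := IsWeightedHomogeneous.prod (R := K) (w := Sum.elim (fun _ : Fin m ↦ ∑ j, r j)
      fun _ : Fin n ↦ m) Finset.univ (fun i : Fin m ↦ X (Sum.inl i)) (fun _ ↦ ∑ j, r j)
      fun i _ ↦ isWeightedHomogeneous_X _ _ _
    simpa using this
  · have := (isWeightedHomogeneous_C (Sum.elim (fun _ : Fin m ↦ ∑ j, r j)
      fun _ : Fin n ↦ m) c).mul (IsWeightedHomogeneous.prod Finset.univ
      (fun j : Fin n ↦ X (Sum.inr j) ^ r j) (fun j ↦ r j • m)
      fun j _ ↦ (isWeightedHomogeneous_X _ _ _).pow _)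
    simpa [← Finset.sum_mul, mul_comm m] using this

theorem prime_multinormPoly (K : Type*) [Field K] (m n : ℕ) (hm : 1 ≤ m) (r : Fin n → ℕ)
    (c : K) (hc : c ≠ 0) : Prime (multinormPoly K m n r c) := by
  classical
  obtain ⟨k, rfl⟩ := Nat.exists_eq_succ_of_ne_zero (Nat.one_le_iff_ne_zero.1 hm)
  rw [← irreducible_iff_prime]
  have hcu : IsUnit (C (-c) : MvPolynomial (Fin (k + 1) ⊕ Fin n) K) :=
    (neg_ne_zero.2 hc).isUnit.map C
  have heq : multinormPoly K (k + 1) n r c =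
      (∏ i : Fin k, X (Sum.inl i.succ)) * X (Sum.inl 0) +
        C (-c) * ∏ j : Fin n, X (Sum.inr j) ^ r j := by
    rw [multinormPoly, Fin.prod_univ_succ, map_neg]
    ring
  rw [heq]
  apply irreducible_mul_X_add
  · exact Finset.prod_ne_zero_iff.2 fun i _ ↦ X_ne_zero _
  · intro h
    obtain ⟨i, -, hi⟩ := Finset.mem_biUnion.1 (vars_prod _ h)
    simp [vars_X, (Fin.succ_ne_zero i).symm] at hi
  · rw [vars_C_mul _ (neg_ne_zero.2 hc)]
    intro h
    obtain ⟨j, -, hj⟩ := Finset.mem_biUnion.1 (vars_prod _ h)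
    simpa [vars_X] using vars_pow _ _ hj
  · rw [isRelPrime_mul_unit_left_right hcu]
    refine IsRelPrime.prod_left fun i _ ↦ IsRelPrime.prod_right fun j _ ↦ IsRelPrime.pow_right ?_
    exact X_prime.irreducible.isRelPrime_iff_not_dvd.2 (by simp [X_dvd_X])

/-- Let `K` be an algebraically closed field of characteristic zero, let
`m, n ≥ 1`, let `r₁, …, r_n ≥ 1` be integers, and let `c ∈ K` be nonzero. Let `A` be the
quotient of `K[w₁, …, w_m, z₁, …, z_n]` by the principal ideal generated by
`w₁⋯w_m − c·z₁^{r₁}⋯z_n^{r_n}`. Then every unit of `A` is the image of a nonzero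
constant of `K`; that is, `A^× = K^×`. -/
theorem units_of_multinorm_quotient (K : Type*) [Field K] [IsAlgClosed K] [CharZero K]
    (m n : ℕ) (hm : 1 ≤ m) (hn : 1 ≤ n) (r : Fin n → ℕ) (hr : ∀ j, 1 ≤ r j)
    (c : K) (hc : c ≠ 0)
    (u : (MvPolynomial (Fin m ⊕ Fin n) K ⧸ Ideal.span {multinormPoly K m n r c})ˣ) :
    ∃ a : Kˣ, (u : MvPolynomial (Fin m ⊕ Fin n) K ⧸ Ideal.span {multinormPoly K m n r c})
      = algebraMap K _ (a : K) := by
  refine (isWeightedHomogeneous_multinormPoly K m n r c).exists_eq_algebraMap_of_isUnit_quotient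
    ?_ (prime_multinormPoly K m n hm r c hc) u.isUnit
  have hsum : ∑ j, r j ≠ 0 := by
    have := Finset.single_le_sum (fun j _ ↦ Nat.zero_le (r j)) (Finset.mem_univ (⟨0, hn⟩ : Fin n))
    have := hr ⟨0, hn⟩
    omega
  rintro (i | j)
  · exact hsum
  · exact Nat.one_le_iff_ne_zero.1 hm
end
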